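/- (Bosonic Bogolubov transformations) Let Y be a finite-dimensional real vector space equipped with a symplectic form ω, and let W be a regular irreducible representation of the CCR over (Y, ω) on a complex Hilbert space H. Let r : Y → Y be a linear map preserving ω (such r is automatically invertible). Then: (a) there exists a unitary operator U on H such that U W(y) U* = W(r y) for all y ∈ Y; (b) U is unique up to a phase factor: if U and U' are two unitaries with this property, then there exists λ ∈ ℂ with |λ| = 1 and U' = λ U. -/

import Mathlib

open scoped MatrixOrder in
theorem skew_root {n : ℕ} (A : Matrix (Fin n) (Fin n) ℝ) (hA : A.transpose = -A) (hdet : IsUnit A.det) :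
    ∃ T K : Matrix (Fin n) (Fin n) ℝ, T.transpose = T ∧ IsUnit T.det ∧ K * K.transpose = 1 ∧ T * K * T = A := by
  have hM : (0 : Matrix (Fin n) (Fin n) ℝ) ≤ A.conjTranspose * A :=
    (Matrix.posSemidef_conjTranspose_mul_self A).nonneg
  rw [Matrix.conjTranspose_eq_transpose_of_trivial] at hM
  set M := A.transpose * A with hMdef
  set S := CFC.sqrt M with hS
  set T := CFC.sqrt S with hT
  have hS0 : 0 ≤ S := CFC.sqrt_nonneg M
  have hT0 : 0 ≤ T := CFC.sqrt_nonneg S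
  have hSS : S * S = M := CFC.sqrt_mul_sqrt_self M hM
  have hTT : T * T = S := CFC.sqrt_mul_sqrt_self S hS0
  have hMA : Commute M A := by
    rw [hMdef, hA]; simp [Commute, SemiconjBy, mul_assoc]
  have hSA : Commute S A := by
    rw [hS, CFC.sqrt]
    exact hMA.cfcₙ_nnreal _
  have hTA : Commute T A := by
    rw [hT, CFC.sqrt]
    exact hSA.cfcₙ_nnreal _
  have hTs : T.transpose = T := by
    have := (Matrix.nonneg_iff_posSemidef.1 hT0).isHermitian
    rwa [Matrix.IsHermitian, Matrix.conjTranspose_eq_transpose_of_trivial] at this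
  have h4 : T * T * (T * T) = M := by rw [hTT, hSS]
  have hTd : IsUnit T.det := by
    have := congrArg Matrix.det h4
    rw [hMdef] at this
    simp only [Matrix.det_mul, Matrix.det_transpose] at this
    rw [isUnit_iff_ne_zero] at hdet ⊢
    intro h0
    rw [h0] at this
    simp at this; exact hdet this
  have h1 := Matrix.nonsing_inv_mul T hTd
  have h2 := Matrix.mul_nonsing_inv T hTd
  set R := T⁻¹ with hR
  have hRs : R.transpose = R := by rw [hR, Matrix.transpose_nonsing_inv, hTs]
  have hRA : R * A = A * R := by
    calc R * A = R * (A * T) * R := by rw [mul_assoc, mul_assoc, h2, mul_one]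
      _ = R * (T * A) * R := by rw [hTA.eq]
      _ = A * R := by rw [← mul_assoc, h1, one_mul]
  refine ⟨T, R * A * R, hTs, hTd, ?_, ?_⟩
  · rw [Matrix.transpose_mul, Matrix.transpose_mul, hRs]
    have hAM : A * A.transpose = M := by rw [hMdef, hA]; simp
    have hRAT : A.transpose * R = R * A.transpose := by rw [hA]; simp [hRA]
    have : R * A * R * (R * (A.transpose * R)) = R * R * (R * R * (A * A.transpose)) := by
      rw [hRAT, hRA]
      have hRRA : A * (R * R * R * R) = R * R * R * R * A := by
        have hc : Commute A R := hRA.symm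
        exact (((hc.mul_right hc).mul_right hc).mul_right hc).eq
      calc A * R * R * (R * (R * A.transpose)) = A * (R * R * R * R) * A.transpose := by
            simp only [mul_assoc]
        _ = _ := by rw [hRRA]; simp only [mul_assoc]
    rw [this, hAM, ← h4]
    calc R * R * (R * R * (T * T * (T * T))) = R * (R * (R * ((R * T) * T) * T) * T) := by simp only [mul_assoc]
      _ = 1 := by simp [h1]
  · calc T * (R * A * R) * T = (T * R) * A * (R * T) := by simp only [mul_assoc]
      _ = A := by simp [h1, h2]

theorem darboux {Y : Type*} [AddCommGroup Y] [Module ℝ Y] [FiniteDimensional ℝ Y]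
    (ω : Y →ₗ[ℝ] Y →ₗ[ℝ] ℝ)
    (hanti : ∀ y₁ y₂ : Y, ω y₁ y₂ = - ω y₂ y₁)
    (hnondeg : ∀ y₁ : Y, y₁ ≠ 0 → ∃ y₂ : Y, ω y₂ y₁ ≠ 0) :
    ∃ (n : ℕ) (φ : Y ≃ₗ[ℝ] EuclideanSpace ℝ (Fin n))
      (J : EuclideanSpace ℝ (Fin n) →ₗ[ℝ] EuclideanSpace ℝ (Fin n)),
      (∀ x, ‖J x‖ = ‖x‖) ∧ ∀ x y, ω x y = inner ℝ (J (φ x)) (φ y) := by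
  let n := Module.finrank ℝ Y
  let b : Module.Basis (Fin n) ℝ Y := Module.finBasis ℝ Y
  let A : Matrix (Fin n) (Fin n) ℝ := LinearMap.toMatrix₂ b b ω
  have hA : A.transpose = -A := by
    ext i j
    simp only [A, Matrix.transpose_apply, LinearMap.toMatrix₂_apply, Matrix.neg_apply]
    rw [hanti]
  have hform : ∀ x y, ω x y = dotProduct (b.equivFun x) (A.mulVec (b.equivFun y)) := by
    intro x y
    rw [← Matrix.toLinearMap₂_toMatrix₂ b b ω, Matrix.toLinearMap₂_apply] 
    simp [dotProduct, Matrix.mulVec, A, Finset.mul_sum]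
    refine Finset.sum_congr rfl fun i _ => Finset.sum_congr rfl fun j _ => ?_
    ring
  have hdet : IsUnit A.det := by
    rw [isUnit_iff_ne_zero]
    intro h0
    obtain ⟨v, hv, hv0⟩ := Matrix.exists_mulVec_eq_zero_iff.2 h0
    obtain ⟨y, hy⟩ := hnondeg (b.equivFun.symm v) (by rwa [Ne, LinearEquiv.map_eq_zero_iff])
    apply hy
    rw [hform, LinearEquiv.apply_symm_apply, hv0, dotProduct_zero]
  obtain ⟨T, K, hTs, hTd, hK, hTKT⟩ := skew_root A hA hdet
  let φ : Y ≃ₗ[ℝ] EuclideanSpace ℝ (Fin n) :=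
    (b.equivFun.trans (Matrix.toLin'OfInv (Matrix.nonsing_inv_mul T hTd) (Matrix.mul_nonsing_inv T hTd))).trans
      (WithLp.linearEquiv 2 ℝ (Fin n → ℝ)).symm
  have hφ : ∀ y, φ y = WithLp.toLp 2 (T.mulVec (b.equivFun y)) := by
    intro y
    rfl
  refine ⟨n, φ, Matrix.toEuclideanLin K.transpose, ?_, ?_⟩
  · intro x
    have : inner ℝ (Matrix.toEuclideanLin K.transpose x) (Matrix.toEuclideanLin K.transpose x) = inner ℝ x x := by
      simp only [EuclideanSpace.inner_eq_star_dotProduct, star_trivial]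
      simp only [Matrix.ofLp_toLpLin, Matrix.toLin'_apply]
      rw [Matrix.mulVec_transpose, ← Matrix.dotProduct_mulVec, ← Matrix.mulVec_transpose, Matrix.mulVec_mulVec, hK, Matrix.one_mulVec]
    rw [real_inner_self_eq_norm_sq, real_inner_self_eq_norm_sq] at this
    exact (sq_eq_sq₀ (norm_nonneg _) (norm_nonneg _)).1 this
  · intro x y
    rw [hform, hφ, hφ]
    simp only [EuclideanSpace.inner_eq_star_dotProduct, star_trivial]
    simp only [Matrix.ofLp_toLpLin, Matrix.toLin'_apply]
    rw [dotProduct_comm (T.mulVec _), Matrix.mulVec_transpose, ← Matrix.dotProduct_mulVec,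
      Matrix.mulVec_mulVec, ← Matrix.vecMul_transpose T, hTs, ← Matrix.dotProduct_mulVec,
      Matrix.mulVec_mulVec, ← hTKT, mul_assoc]


section CCR

open MeasureTheory Complex
open scoped FourierTransform ComplexConjugate

set_option linter.unusedSectionVars false

variable {V : Type*} [NormedAddCommGroup V] [InnerProductSpace ℝ V] [FiniteDimensional ℝ V]
  [MeasurableSpace V] [BorelSpace V]
  {H : Type*} [NormedAddCommGroup H] [InnerProductSpace ℂ H] [CompleteSpace H]

/-- phase factor -/
noncomputable def ph (J : V →ₗ[ℝ] V) (x y : V) : ℂ := cexp (-(I / 2) * ((inner ℝ (J x) y : ℝ) : ℂ))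

/-- Gaussian -/
noncomputable def Ga (y : V) : ℂ := cexp (-(1 / 4 : ℂ) * (‖y‖ : ℂ) ^ 2)

/-- regular representations of the CCR, in Darboux form -/
structure CCRRep (J : V →ₗ[ℝ] V) (W : V → H →L[ℂ] H) : Prop where
  skew : ∀ x y, inner ℝ (J x) y = - inner ℝ (J y) x
  iso : ∀ x, ‖J x‖ = ‖x‖
  unit : ∀ y, W y ∈ unitary (H →L[ℂ] H)
  weyl : ∀ x y, W x * W y = ph J x y • W (x + y)
  cont : ∀ v, Continuous fun y => W y v

/-- Gaussian average -/
noncomputable def vac (W : V → H →L[ℂ] H) (v : H) : H := ∫ y, Ga y • W y v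

theorem Ga_continuous : Continuous (Ga : V → ℂ) := by unfold Ga; fun_prop

theorem Ga_integrable : Integrable (Ga : V → ℂ) := by
  have := GaussianFourier.integrable_cexp_neg_mul_sq_norm_add (V := V) (b := (1 / 4 : ℂ)) (by norm_num) 0 0
  unfold Ga
  simpa using this

theorem Ga_zero : Ga (0 : V) = 1 := by simp [Ga]

theorem Ga_neg (y : V) : Ga (-y) = Ga y := by simp [Ga]

theorem Ga_conj (y : V) : conj (Ga y) = Ga y := by
  unfold Ga
  rw [← Complex.exp_conj]
  simp [Complex.conj_ofNat]

theorem ph_norm (J : V →ₗ[ℝ] V) (x y : V) : ‖ph J x y‖ = 1 := by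
  unfold ph
  rw [Complex.norm_exp]
  simp

variable {J : V →ₗ[ℝ] V} {W : V → H →L[ℂ] H}

theorem ph_continuous : Continuous fun p : V × V => ph J p.1 p.2 := by
  have : Continuous J := J.continuous_of_finiteDimensional
  unfold ph; fun_prop

namespace CCRRep

theorem self (h : CCRRep J W) (x : V) : inner ℝ (J x) x = 0 := by
  have := h.skew x x; linarith

theorem ph_self (h : CCRRep J W) (x : V) : ph J x x = 1 := by simp [ph, h.self]

theorem W_zero (h : CCRRep J W) : W 0 = 1 := by
  have h1 := h.weyl 0 0
  rw [h.ph_self, one_smul, add_zero] at h1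
  have h2 := (Unitary.mem_iff.1 (h.unit 0)).1
  calc W 0 = star (W 0) * W 0 * W 0 := by rw [h2, one_mul]
    _ = 1 := by rw [mul_assoc, h1, h2]

theorem W_neg (h : CCRRep J W) (y : V) : W (-y) * W y = 1 := by
  rw [h.weyl]; simp [ph, h.self, h.W_zero]

theorem star_W (h : CCRRep J W) (y : V) : star (W y) = W (-y) := by
  have h2 := (Unitary.mem_iff.1 (h.unit y)).2
  calc star (W y) = W (-y) * W y * star (W y) := by rw [h.W_neg, one_mul]
    _ = W (-y) := by rw [mul_assoc, h2, mul_one]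

theorem inner_W (h : CCRRep J W) (y : V) (u v : H) : inner ℂ (W y u) v = inner ℂ u (W (-y) v) := by
  rw [← h.star_W, ContinuousLinearMap.star_eq_adjoint, ContinuousLinearMap.adjoint_inner_right]

theorem norm_W (h : CCRRep J W) (y : V) (v : H) : ‖W y v‖ = ‖v‖ :=
  ContinuousLinearMap.norm_map_of_mem_unitary (h.unit y) v

theorem W_W (h : CCRRep J W) (x y : V) (v : H) : W x (W y v) = ph J x y • W (x + y) v := by
  rw [← mul_apply_eq_comp, h.weyl]; rfl

theorem integ (h : CCRRep J W) (v : H) : Integrable fun y => Ga y • W y v := by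
  refine (Ga_integrable.norm.mul_const ‖v‖).mono' (Ga_continuous.smul (h.cont v)).aestronglyMeasurable ?_
  filter_upwards with y
  rw [norm_smul, h.norm_W]

theorem vac_smul (_h : CCRRep J W) (c : ℂ) (v : H) : vac W (c • v) = c • vac W v := by
  unfold vac
  rw [← integral_smul]
  simp only [map_smul, smul_comm c]

theorem vac_comm (h : CCRRep J W) (T : H →L[ℂ] H) (hT : ∀ y, T * W y = W y * T) (v : H) :
    T (vac W v) = vac W (T v) := by
  unfold vac
  rw [← ContinuousLinearMap.integral_comp_comm _ (h.integ v)]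
  refine integral_congr_ae (Filter.Eventually.of_forall fun y => ?_)
  have := DFunLike.congr_fun (hT y) v
  simp only [mul_apply_eq_comp] at this
  simp [this]

theorem vac_symm (h : CCRRep J W) (u v : H) : inner ℂ (vac W u) v = inner ℂ u (vac W v) := by
  unfold vac
  rw [← inner_conj_symm, ← integral_inner (h.integ u), ← integral_inner (h.integ v), ← integral_conj,
    ← integral_neg_eq_self]
  refine integral_congr_ae (Filter.Eventually.of_forall fun y => ?_)
  simp only [inner_smul_right, Ga_neg]
  rw [map_mul, Ga_conj, inner_conj_symm, h.inner_W, neg_neg]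

theorem J_surj (h : CCRRep J W) : Function.Surjective J := by
  apply LinearMap.surjective_of_injective
  rw [← LinearMap.ker_eq_bot, LinearMap.ker_eq_bot']
  intro x hx
  rw [← norm_eq_zero, ← h.iso, hx, norm_zero]

theorem exists_vac_ne [Nontrivial H] (h : CCRRep J W) : ∃ v, vac W v ≠ 0 := by
  by_contra! hv
  obtain ⟨v, hv0⟩ := exists_ne (0 : H)
  have hF : 𝓕 (fun y : V => Ga y • W y v) = 0 := by
    funext ξ
    obtain ⟨z, hz⟩ := h.J_surj (-(2 * Real.pi) • ξ)
    have h0 : W (-z) (vac W (W z v)) = 0 := by rw [hv, map_zero]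
    rw [Real.fourier_eq', Pi.zero_apply, ← h0]
    unfold vac
    rw [← ContinuousLinearMap.integral_comp_comm _ (h.integ _)]
    refine integral_congr_ae (Filter.Eventually.of_forall fun y => ?_)
    simp only [map_smul, h.W_W, smul_smul]
    rw [show -z + (y + z) = y by abel]
    congr 1
    refine Eq.trans (mul_comm _ _) (Eq.trans ?_ (mul_assoc _ _ _).symm)
    congr 1
    unfold ph
    rw [← Complex.exp_add]
    congr 1
    have e1 : inner ℝ (J y) z = 2 * Real.pi * inner ℝ y ξ := by
      rw [h.skew, hz, inner_smul_left, real_inner_comm]; simp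
    have e2 : inner ℝ (J (-z)) (y + z) = 2 * Real.pi * inner ℝ y ξ := by
      rw [map_neg, hz, inner_add_right]
      have := h.self z
      rw [hz] at this
      rw [inner_neg_left, inner_neg_left, this, inner_smul_left, real_inner_comm]; simp
    rw [e1, e2]
    push_cast
    ring
  have hc : Continuous (fun y : V => Ga y • W y v) := Ga_continuous.smul (h.cont v)
  have := hc.fourierInv_fourier_eq (h.integ v) (by rw [hF]; exact integrable_zero _ _ _)
  rw [hF] at this
  have h1 := congrFun this 0
  rw [Real.fourierInv_eq'] at h1
  simp [Ga_zero, h.W_zero] at h1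
  exact hv0 h1.symm

end CCRRep

/-- normalisation constant -/
noncomputable def CC (V : Type*) [NormedAddCommGroup V] [InnerProductSpace ℝ V] : ℂ :=
  (Real.pi / (1 / 2 : ℂ)) ^ (Module.finrank ℝ V / 2 : ℂ)

/-- integral kernel -/
noncomputable def Ker (J : V →ₗ[ℝ] V) (z x w : V) : ℂ :=
  Ga x * Ga (w - (x + z)) * (ph J x z * ph J (x + z) (w - (x + z)))

theorem CCRRep.ker_shift (h : CCRRep J W) (z x w : V) :
    Ker J z (x + (1 / 2 : ℝ) • (w - z)) w =
      cexp (-(1 / 8 : ℂ) * (‖w - z‖ : ℂ) ^ 2) *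
        cexp (-(1 / 2 : ℂ) * (‖x‖ : ℂ) ^ 2 + (I / 2) * ((inner ℝ (J (w + z)) x : ℝ) : ℂ)) := by
  set x' := x + (1 / 2 : ℝ) • (w - z) with hx'
  have h1 : ‖x'‖ ^ 2 + ‖w - (x' + z)‖ ^ 2 = 2 * ‖x‖ ^ 2 + ‖w - z‖ ^ 2 / 2 := by
    have e : w - (x' + z) = (1 / 2 : ℝ) • (w - z) - x := by
      rw [hx']; module
    rw [e, hx', norm_add_sq_real, norm_sub_sq_real, real_inner_comm, norm_smul]
    norm_num
    ring
  have h2 : inner ℝ (J x') z + inner ℝ (J (x' + z)) (w - (x' + z)) = - inner ℝ (J (w + z)) x := by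
    have a1 := h.self x
    have a2 := h.self w
    have a3 := h.self z
    have a4 := h.skew x w
    have a5 := h.skew x z
    have a6 := h.skew w z
    rw [hx']
    simp only [map_add, map_sub, map_smul, inner_add_left, inner_add_right, inner_sub_left,
      inner_sub_right, inner_smul_left, inner_smul_right, conj_trivial]
    linarith
  unfold Ker Ga ph
  rw [← Complex.exp_add, ← Complex.exp_add, ← Complex.exp_add, ← Complex.exp_add]
  congr 1
  have h1c := congrArg (fun t : ℝ => (t : ℂ)) h1
  have h2c := congrArg (fun t : ℝ => (t : ℂ)) h2
  push_cast at h1c h2c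
  linear_combination (-(1 / 4 : ℂ)) * h1c + (-(I / 2)) * h2c

theorem CCRRep.integral_ker (h : CCRRep J W) (z w : V) :
    ∫ x, Ker J z x w = CC V * Ga z * Ga w := by
  rw [← integral_add_right_eq_self _ ((1 / 2 : ℝ) • (w - z))]
  simp only [h.ker_shift]
  rw [integral_const_mul, GaussianFourier.integral_cexp_neg_mul_sq_norm_add (by norm_num), h.iso]
  unfold CC Ga
  have e : ∀ a b c d f : ℂ, a + b = d + f → cexp a * (c * cexp b) = c * cexp d * cexp f := by
    intro a b c d f hh
    rw [mul_assoc, ← Complex.exp_add, ← hh, Complex.exp_add]; ring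
  apply e
  have h3 := parallelogram_law_with_norm ℝ w z
  have h3c := congrArg (fun t : ℝ => (t : ℂ)) h3
  push_cast at h3c
  linear_combination (-(1 / 8 : ℂ)) * h3c + (‖w + z‖ : ℂ) ^ 2 / 8 * Complex.I_sq

theorem Ker_continuous (z : V) : Continuous fun p : V × V => Ker J z p.1 p.2 := by
  unfold Ker
  have := Ga_continuous (V := V)
  refine ((this.comp continuous_fst).mul (this.comp (by fun_prop))).mul ?_
  exact ((ph_continuous (J := J)).comp (by fun_prop : Continuous fun p : V × V => (p.1, z))).mul
    ((ph_continuous (J := J)).comp (by fun_prop : Continuous fun p : V × V => (p.1 + z, p.2 - (p.1 + z))))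

theorem CCRRep.integ2 (h : CCRRep J W) (z : V) (v : H) :
    Integrable (Function.uncurry fun x w => Ker J z x w • W w v) ((volume : Measure V).prod volume) := by
  have hG := Ga_integrable (V := V)
  have h1 : Integrable (fun w : V => Ga (w - z)) := hG.comp_sub_right z
  have h2 := (hG.convolution_integrand (ContinuousLinearMap.mul ℂ ℂ) h1).swap
  refine (h2.norm.mul_const ‖v‖).mono' ?_ ?_
  · exact ((Ker_continuous z).smul ((h.cont v).comp continuous_snd)).aestronglyMeasurable
  · filter_upwards with p
    simp only [Function.uncurry, norm_smul, h.norm_W, Ker, norm_mul, ph_norm, mul_one,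
      Function.comp_apply, Prod.swap, ContinuousLinearMap.mul_apply', sub_sub]
    exact le_rfl

theorem CCRRep.vac_W_vac (h : CCRRep J W) (z : V) (v : H) :
    vac W (W z (vac W v)) = (CC V * Ga z) • vac W v := by
  have s1 : vac W (W z (vac W v)) = ∫ x, ∫ w, Ker J z x w • W w v := by
    conv_lhs => unfold vac
    refine integral_congr_ae (Filter.Eventually.of_forall fun x => ?_)
    simp only
    rw [← ContinuousLinearMap.integral_comp_comm _ (h.integ v),
      ← ContinuousLinearMap.integral_comp_comm _ ((W z).integrable_comp (h.integ v)), ← integral_smul,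
      ← integral_sub_right_eq_self _ (x + z)]
    refine integral_congr_ae (Filter.Eventually.of_forall fun w => ?_)
    simp only [map_smul, h.W_W, smul_smul, Ker]
    rw [show x + (z + (w - (x + z))) = w by abel]
    congr 1
    have hp : ph J z (w - (x + z)) * ph J x (z + (w - (x + z))) =
        ph J x z * ph J (x + z) (w - (x + z)) := by
      unfold ph
      rw [← Complex.exp_add, ← Complex.exp_add]
      congr 1
      simp only [map_add, inner_add_left, inner_add_right]
      push_cast
      ring
    rw [← hp]; ring
  rw [s1, integral_integral_swap (h.integ2 z v)]
  simp only [integral_smul_const, h.integral_ker]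
  unfold vac
  rw [← integral_smul]
  simp only [smul_smul]

theorem CC_ne : CC V ≠ 0 := by
  unfold CC
  rw [Complex.cpow_def_of_ne_zero]
  · exact Complex.exp_ne_zero _
  · simp [Real.pi_ne_zero]

theorem CCRRep.exists_vacuum [Nontrivial H] (h : CCRRep J W) :
    ∃ Ω : H, ‖Ω‖ = 1 ∧ (∀ z, inner ℂ Ω (W z Ω) = Ga z) ∧ ∀ z, vac W (W z Ω) = (CC V * Ga z) • Ω := by
  obtain ⟨v, hv⟩ := h.exists_vac_ne
  set u := ((‖vac W v‖⁻¹ : ℝ) : ℂ) • v with hu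
  have hn : ‖vac W u‖ = 1 := by
    rw [hu, h.vac_smul, norm_smul]
    simp [hv]
  refine ⟨vac W u, hn, ?_, fun z => h.vac_W_vac z u⟩
  have h1 : ∀ z, inner ℂ (vac W u) (W z (vac W u)) = CC V * Ga z * inner ℂ u (vac W u) := by
    intro z
    rw [h.vac_symm, h.vac_W_vac, inner_smul_right]
  have h2 := h1 0
  rw [h.W_zero, Ga_zero, one_apply_eq_self, inner_self_eq_norm_sq_to_K, hn] at h2
  intro z
  rw [h1]
  calc CC V * Ga z * inner ℂ u (vac W u) = Ga z * (CC V * 1 * inner ℂ u (vac W u)) := by ring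
    _ = Ga z := by rw [← h2]; simp

/-- irreducibility -/
def Irr (W : V → H →L[ℂ] H) : Prop := ∀ S : Submodule ℂ H, IsClosed (S : Set H) →
      (∀ y, ∀ x ∈ S, W y x ∈ S) → S = ⊥ ∨ S = ⊤

theorem CCRRep.cyclic (h : CCRRep J W) (hi : Irr W) (Ω : H) (hΩ : Ω ≠ 0) (x : H)
    (hx : ∀ z, inner ℂ x (W z Ω) = 0) : x = 0 := by
  let S : Submodule ℂ H := ⨅ z, LinearMap.ker ((innerSL ℂ x ∘L W z : H →L[ℂ] ℂ) : H →ₗ[ℂ] ℂ)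
  have hmem : ∀ y, y ∈ S ↔ ∀ z, inner ℂ x (W z y) = 0 := by
    intro y; simp [S, Submodule.mem_iInf]
  have hcl : IsClosed (S : Set H) := by
    have : (S : Set H) = ⋂ z, {y | inner ℂ x (W z y) = 0} := by
      ext y; simp [hmem]
    rw [this]
    refine isClosed_iInter fun z => isClosed_eq (by fun_prop) continuous_const
  rcases hi S hcl (by
    intro y u hu
    rw [hmem] at hu ⊢
    intro z
    rw [h.W_W, inner_smul_right, hu, mul_zero]) with hb | ht
  · exfalso; apply hΩ
    have : Ω ∈ S := (hmem Ω).2 hx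
    rwa [hb, Submodule.mem_bot] at this
  · have : x ∈ S := by rw [ht]; trivial
    have := (hmem x).1 this 0
    rw [h.W_zero] at this
    simpa using this

theorem CCRRep.schur [Nontrivial H] (h : CCRRep J W) (hi : Irr W) (T : H →L[ℂ] H)
    (hT : ∀ y, T * W y = W y * T) : ∃ lam : ℂ, T = lam • 1 := by
  obtain ⟨Ω, hn, hG, hv⟩ := h.exists_vacuum
  have hΩ : Ω ≠ 0 := by rw [← norm_ne_zero_iff, hn]; norm_num
  have hTv := h.vac_comm T hT
  have hv0 : vac W Ω = CC V • Ω := by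
    have := hv 0
    rwa [h.W_zero, Ga_zero, mul_one] at this
  set lam := inner ℂ Ω (T Ω) with hlam
  have hx0 : ∀ z, inner ℂ (T Ω - lam • Ω) (W z Ω) = 0 := by
    intro z
    have e1 : inner ℂ (T Ω) (W z Ω) * conj (CC V) = CC V * Ga z * inner ℂ (T Ω) Ω := by
      rw [← inner_smul_right, ← hv z, ← h.vac_symm, ← hTv, hv0, map_smul, inner_smul_left, mul_comm]
    have e2 : inner ℂ Ω (W z Ω) * conj (CC V) = CC V * Ga z * inner ℂ Ω Ω := by
      rw [← inner_smul_right, ← hv z, ← h.vac_symm, hv0, inner_smul_left, mul_comm]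
    have e3 : inner ℂ (T Ω) Ω = conj lam := by rw [hlam, inner_conj_symm]
    have e4 : inner ℂ Ω Ω = (1 : ℂ) := by rw [inner_self_eq_norm_sq_to_K, hn]; simp
    have hc : conj (CC V) ≠ 0 := by simpa using CC_ne (V := V)
    apply mul_right_cancel₀ hc
    rw [inner_sub_left, inner_smul_left, sub_mul, e1, mul_assoc (conj lam), e2, e3, e4]
    ring
  have hTΩ : T Ω = lam • Ω := sub_eq_zero.1 (h.cyclic hi Ω hΩ _ hx0)
  refine ⟨lam, ?_⟩
  let S : Submodule ℂ H := LinearMap.ker ((T - lam • 1 : H →L[ℂ] H) : H →ₗ[ℂ] H)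
  have hmem : ∀ y, y ∈ S ↔ T y = lam • y := by
    intro y; simp [S, sub_eq_zero]
  have hcl : IsClosed (S : Set H) := (T - lam • 1 : H →L[ℂ] H).isClosed_ker
  rcases hi S hcl (by
    intro y u hu
    rw [hmem] at hu ⊢
    have := DFunLike.congr_fun (hT y) u
    simp only [mul_apply_eq_comp] at this
    rw [this, hu, map_smul]) with hb | ht
  · exfalso; apply hΩ
    have : Ω ∈ S := (hmem Ω).2 hTΩ
    rwa [hb, Submodule.mem_bot] at this
  · ext y
    have : y ∈ S := by rw [ht]; trivial
    simpa using (hmem y).1 this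

theorem CCRRep.dense (h : CCRRep J W) (hi : Irr W) (Ω : H) (hΩ : Ω ≠ 0) :
    DenseRange (Finsupp.linearCombination ℂ (fun z => W z Ω)) := by
  have : (Submodule.span ℂ (Set.range fun z => W z Ω)).topologicalClosure = ⊤ := by
    rw [Submodule.topologicalClosure_eq_top_iff, Submodule.eq_bot_iff]
    intro x hx
    apply h.cyclic hi Ω hΩ
    intro z
    rw [Submodule.mem_orthogonal'] at hx
    exact hx _ (Submodule.subset_span ⟨z, rfl⟩)
  rw [← Finsupp.range_linearCombination] at this
  rw [DenseRange, ← LinearMap.coe_range]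
  exact (Submodule.dense_iff_topologicalClosure_eq_top).2 this

theorem CCRRep.stone_vonNeumann [Nontrivial H] {W' : V → H →L[ℂ] H} (h : CCRRep J W) (hi : Irr W)
    (h' : CCRRep J W') (hi' : Irr W') :
    ∃ U : H ≃ₗᵢ[ℂ] H, ∀ y v, U (W y v) = W' y (U v) := by
  obtain ⟨Ω, hn, hG, -⟩ := h.exists_vacuum
  obtain ⟨Ω', hn', hG', -⟩ := h'.exists_vacuum
  have hΩ : Ω ≠ 0 := by rw [← norm_ne_zero_iff, hn]; norm_num
  have hΩ' : Ω' ≠ 0 := by rw [← norm_ne_zero_iff, hn']; norm_num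
  have hd := h.dense hi Ω hΩ
  have hd' := h'.dense hi' Ω' hΩ'
  set A := Finsupp.linearCombination ℂ (fun z => W z Ω) with hA
  set B := Finsupp.linearCombination ℂ (fun z => W' z Ω') with hB
  have hgram : ∀ x y, inner ℂ (W' x Ω') (W' y Ω') = inner ℂ (W x Ω) (W y Ω) := by
    intro x y
    rw [h.inner_W, h'.inner_W, h.W_W, h'.W_W, inner_smul_right, inner_smul_right, hG, hG']
  have hinner : ∀ f g, inner ℂ (B f) (B g) = inner ℂ (A f) (A g) := by
    intro f g
    simp only [hA, hB, Finsupp.linearCombination_apply, Finsupp.sum_inner, Finsupp.inner_sum,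
      inner_smul_left, inner_smul_right, hgram]
  have hnorm : ∀ f, ‖B (LinearEquiv.refl ℂ _ f)‖ = ‖A f‖ := by
    intro f
    have := hinner f f
    rw [inner_self_eq_norm_sq_to_K, inner_self_eq_norm_sq_to_K] at this
    have h2 : ‖B f‖ ^ 2 = ‖A f‖ ^ 2 := by exact_mod_cast this
    exact (sq_eq_sq₀ (norm_nonneg _) (norm_nonneg _)).1 h2
  let U := (LinearEquiv.refl ℂ (V →₀ ℂ)).extendOfIsometry A B hd hd' hnorm
  have hU : ∀ f, U (A f) = B f := fun f =>
    LinearEquiv.extendOfIsometry_eq (LinearEquiv.refl ℂ (V →₀ ℂ)) A B hd hd' hnorm f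
  have hU1 : ∀ z, U (W z Ω) = W' z Ω' := by
    intro z
    simpa [hA, hB] using hU (Finsupp.single z 1)
  refine ⟨U, fun y v => ?_⟩
  refine hd.induction_on (p := fun v => U (W y v) = W' y (U v)) v
    (isClosed_eq (by fun_prop) (by fun_prop)) ?_
  intro f
  induction f using Finsupp.induction_linear with
  | zero => simp
  | add f g hf hg => simp only [map_add, hf, hg]
  | single z c =>
    simp only [hA, Finsupp.linearCombination_single, map_smul, h.W_W, hU1, h'.W_W]

theorem strong_comp (A : V → H →L[ℂ] H) (hA : ∀ y u, ‖A y u‖ = ‖u‖)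
    (hc : ∀ u, Continuous fun y => A y u) (F : V → H) (hF : Continuous F) :
    Continuous fun y => A y (F y) := by
  rw [continuous_iff_continuousAt]
  intro y₀
  have h1 : Filter.Tendsto (fun y => A y (F y - F y₀)) (nhds y₀) (nhds 0) := by
    rw [tendsto_zero_iff_norm_tendsto_zero]
    simp only [hA]
    have : Filter.Tendsto (fun y => ‖F y - F y₀‖) (nhds y₀) (nhds ‖F y₀ - F y₀‖) :=
      ((hF.sub continuous_const).norm).tendsto y₀
    simpa using this
  have h2 := h1.add ((hc (F y₀)).tendsto y₀)
  simpa [ContinuousAt] using h2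

theorem cont_of_regular (J : V →ₗ[ℝ] V) (W : V → H →L[ℂ] H)
    (unit : ∀ y, W y ∈ unitary (H →L[ℂ] H))
    (weyl : ∀ x y, W x * W y = ph J x y • W (x + y))
    (hreg : ∀ (y : V) (x : H), Continuous fun t : ℝ => W (t • y) x) (x : H) :
    Continuous fun y => W y x := by
  classical
  let b := stdOrthonormalBasis ℝ V
  have key : ∀ s : Finset (Fin (Module.finrank ℝ V)),
      Continuous fun y : V => W (∑ i ∈ s, (inner ℝ (b i) y : ℝ) • b i) x := by
    intro s
    induction s using Finset.induction_on with
    | empty => simpa using continuous_const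
    | insert i s hi ih =>
      have e : ∀ y : V, W (∑ j ∈ insert i s, (inner ℝ (b j) y : ℝ) • b j) x =
          (ph J ((inner ℝ (b i) y : ℝ) • b i) (∑ j ∈ s, (inner ℝ (b j) y : ℝ) • b j))⁻¹ •
            W ((inner ℝ (b i) y : ℝ) • b i) (W (∑ j ∈ s, (inner ℝ (b j) y : ℝ) • b j) x) := by
        intro y
        rw [Finset.sum_insert hi, ← mul_apply_eq_comp, weyl,
          smul_apply, inv_smul_smul₀]
        rw [← norm_ne_zero_iff, ph_norm]; norm_num
      simp only [e]
      refine Continuous.smul ?_ ?_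
      · refine Continuous.inv₀ ?_ ?_
        · exact (ph_continuous (J := J)).comp
            (by fun_prop : Continuous fun y : V => ((inner ℝ (b i) y : ℝ) • b i, ∑ j ∈ s, (inner ℝ (b j) y : ℝ) • b j))
        · intro y; rw [← norm_ne_zero_iff, ph_norm]; norm_num
      · have hy : ∀ u, Continuous fun y : V => W ((inner ℝ (b i) y : ℝ) • b i) u := fun u =>
          (hreg (b i) u).comp (by fun_prop : Continuous fun y : V => (inner ℝ (b i) y : ℝ))
        exact strong_comp _ (fun y u => ContinuousLinearMap.norm_map_of_mem_unitary (unit _) u) hy _ ih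
  have := key Finset.univ
  simpa only [b.sum_repr'] using this

end CCR


/-- Bosonic Bogolubov transformations.
For a regular irreducible representation `W` of the CCR over a finite-dimensional
symplectic space `(Y, ω)` and a linear map `r` preserving `ω`, there is a unitary `U`
with `U W(y) U* = W(r y)` for all `y`, and `U` is unique up to a phase factor. -/
theorem bosonic_bogolubov_implementation
    {Y : Type*} [AddCommGroup Y] [Module ℝ Y] [FiniteDimensional ℝ Y]
    (ω : Y →ₗ[ℝ] Y →ₗ[ℝ] ℝ)
    (hanti : ∀ y₁ y₂ : Y, ω y₁ y₂ = - ω y₂ y₁)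
    (hnondeg : ∀ y₁ : Y, y₁ ≠ 0 → ∃ y₂ : Y, ω y₂ y₁ ≠ 0)
    {H : Type*} [NormedAddCommGroup H] [InnerProductSpace ℂ H] [CompleteSpace H]
    (W : Y → (H →L[ℂ] H))
    (hunit : ∀ y, W y ∈ unitary (H →L[ℂ] H))
    (hWeyl : ∀ y₁ y₂ : Y, W y₁ * W y₂ =
      Complex.exp (-(Complex.I / 2) * (ω y₁ y₂ : ℂ)) • W (y₁ + y₂))
    (hreg : ∀ (y : Y) (x : H), Continuous fun t : ℝ => W (t • y) x)
    (hirr : ∀ S : Submodule ℂ H, IsClosed (S : Set H) →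
      (∀ y, ∀ x ∈ S, W y x ∈ S) → S = ⊥ ∨ S = ⊤)
    (r : Y →ₗ[ℝ] Y)
    (hr : ∀ y₁ y₂ : Y, ω (r y₁) (r y₂) = ω y₁ y₂) :
    (∃ U : H →L[ℂ] H, U ∈ unitary (H →L[ℂ] H) ∧
      ∀ y : Y, U * W y * star U = W (r y)) ∧
    (∀ U U' : H →L[ℂ] H, U ∈ unitary (H →L[ℂ] H) → U' ∈ unitary (H →L[ℂ] H) →
      (∀ y : Y, U * W y * star U = W (r y)) →
      (∀ y : Y, U' * W y * star U' = W (r y)) →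
      ∃ lam : ℂ, ‖lam‖ = 1 ∧ U' = lam • U) := by
  obtain ⟨n, φ, J, hJ, hωJ⟩ := darboux ω hanti hnondeg
  have hrep : ∀ s : Y →ₗ[ℝ] Y, (∀ y₁ y₂ : Y, ω (s y₁) (s y₂) = ω y₁ y₂) →
      CCRRep J (fun x => W (s (φ.symm x))) := by
    intro s hs
    have hw : ∀ x y, W (s (φ.symm x)) * W (s (φ.symm y)) = ph J x y • W (s (φ.symm (x + y))) := by
      intro x y
      rw [hWeyl, hs, hωJ, map_add, map_add]
      simp [ph]
    refine ⟨?_, hJ, fun y => hunit _, hw, ?_⟩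
    · intro x y
      have := hanti (φ.symm x) (φ.symm y)
      rw [hωJ, hωJ] at this
      simpa using this
    · refine cont_of_regular J _ (fun y => hunit _) hw ?_
      intro y x
      simpa only [map_smul] using hreg (s (φ.symm y)) x
  have hirep : ∀ s : Y →ₗ[ℝ] Y, Function.Surjective s → Irr (fun x => W (s (φ.symm x))) := by
    intro s hs S hcl hS
    refine hirr S hcl ?_
    intro y x hx
    obtain ⟨y', rfl⟩ := hs y
    simpa using hS (φ y') x hx
  have hrsurj : Function.Surjective r := by
    apply LinearMap.surjective_of_injective
    rw [← LinearMap.ker_eq_bot, LinearMap.ker_eq_bot']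
    intro x hx
    by_contra hne
    obtain ⟨y, hy⟩ := hnondeg x hne
    apply hy
    rw [← hr, hx, map_zero]
  rcases subsingleton_or_nontrivial H with hsub | hnt
  · have hall : ∀ A B : H →L[ℂ] H, A = B := fun A B => by
      ext x; exact Subsingleton.elim _ _
    exact ⟨⟨1, one_mem _, fun y => hall _ _⟩, fun U U' _ _ _ _ => ⟨1, by simp, hall _ _⟩⟩
  have hW := hrep LinearMap.id (fun _ _ => rfl)
  have hWi := hirep LinearMap.id Function.surjective_id
  constructor
  · obtain ⟨U, hU⟩ := hW.stone_vonNeumann hWi (hrep r hr) (hirep r hrsurj)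
    let U₁ : H →L[ℂ] H := (U : H →L[ℂ] H)
    have hmem : U₁ ∈ unitary (H →L[ℂ] H) := by
      have hs : star U₁ = (U.symm : H →L[ℂ] H) := by
        rw [ContinuousLinearMap.star_eq_adjoint]
        exact LinearIsometryEquiv.adjoint_eq_symm U
      rw [Unitary.mem_iff, hs]
      constructor <;> · ext x; simp [U₁]
    refine ⟨U₁, hmem, fun y => ?_⟩
    have hc : U₁ * W y = W (r y) * U₁ := by
      ext x
      have := hU (φ y) x
      simpa [U₁] using this
    rw [hc, mul_assoc, (Unitary.mem_iff.1 hmem).2, mul_one]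
  · intro U U' hU hU' hUW hUW'
    rw [Unitary.mem_iff] at hU hU'
    have c1 : ∀ y, star U * W (r y) = W y * star U := by
      intro y
      rw [← hUW, ← mul_assoc, ← mul_assoc, hU.1, one_mul]
    have c2 : ∀ y, U' * W y = W (r y) * U' := by
      intro y
      rw [← hUW', mul_assoc, hU'.1, mul_one]
    have hT : ∀ x, (star U * U') * W ((LinearMap.id : Y →ₗ[ℝ] Y) (φ.symm x)) =
        W ((LinearMap.id : Y →ₗ[ℝ] Y) (φ.symm x)) * (star U * U') := by
      intro x
      rw [mul_assoc, c2, ← mul_assoc, LinearMap.id_apply, c1, mul_assoc]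
    obtain ⟨lam, hlam⟩ := hW.schur hWi (star U * U') hT
    have hUU : U' = lam • U := by
      calc U' = U * (star U * U') := by rw [← mul_assoc, hU.2, one_mul]
        _ = lam • U := by rw [hlam]; simp
    refine ⟨lam, ?_, hUU⟩
    obtain ⟨v, hv⟩ := exists_ne (0 : H)
    have n1 : ‖U' v‖ = ‖v‖ := ContinuousLinearMap.norm_map_of_mem_unitary (Unitary.mem_iff.2 hU') v
    have n2 : ‖U v‖ = ‖v‖ := ContinuousLinearMap.norm_map_of_mem_unitary (Unitary.mem_iff.2 hU) v
    rw [hUU, smul_apply, norm_smul, n2] at n1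
    have hv' : ‖v‖ ≠ 0 := norm_ne_zero_iff.2 hv
    exact mul_right_cancel₀ hv' (by rw [n1, one_mul])
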